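/- arXiv:1106.0036 — 3 statements merged into one kernel-verified Lean document; each statement's English description precedes it below -/
import Mathlib

section
/- Let α ∈ ℂ^{N×N} and let (β_n)_{n≥1} be a sequence in ℂ^{N×N} satisfying: (i) β_{n+2}β_{n+1} + β_{n+1}² − β_n² − β_n β_{n−1} + α(β_{n+1} − β_n) = I_N for all n ≥ 2; (ii) β_3 β_2 + β_2² − β_1² + α(β_2 − β_1) = I_N; and (iii) β_2 β_1 + β_1² + α β_1 = I_N. Then for every n ≥ 1: β_{n+2} β_{n+1} + β_{n+1} β_n + β_{n+1}² + α β_{n+1} = (n+1) I_N. -/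
open Matrix

/-- Let `α ∈ ℂ^{N×N}` and `(β_n)_{n≥1}` in `ℂ^{N×N}` satisfy
(i) `β_{n+2}β_{n+1} + β_{n+1}² − β_n² − β_n β_{n−1} + α(β_{n+1} − β_n) = I` for all `n ≥ 2`;
(ii) `β_3 β_2 + β_2² − β_1² + α(β_2 − β_1) = I`; and (iii) `β_2 β_1 + β_1² + α β_1 = I`.
Then for every `n ≥ 1`:
`β_{n+2} β_{n+1} + β_{n+1} β_n + β_{n+1}² + α β_{n+1} = (n+1) I`. -/
theorem summed_painleve_identity
    {N : ℕ} (hN : 1 ≤ N) (α : Matrix (Fin N) (Fin N) ℂ)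
    (β : ℕ → Matrix (Fin N) (Fin N) ℂ)
    (h1 : ∀ n : ℕ, 2 ≤ n →
      β (n + 2) * β (n + 1) + β (n + 1) ^ 2 - β n ^ 2 - β n * β (n - 1) +
          α * (β (n + 1) - β n) = (1 : Matrix (Fin N) (Fin N) ℂ))
    (h2 : β 3 * β 2 + β 2 ^ 2 - β 1 ^ 2 + α * (β 2 - β 1) = (1 : Matrix (Fin N) (Fin N) ℂ))
    (h3 : β 2 * β 1 + β 1 ^ 2 + α * β 1 = (1 : Matrix (Fin N) (Fin N) ℂ)) :
    ∀ n : ℕ, 1 ≤ n →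
      β (n + 2) * β (n + 1) + β (n + 1) * β n + β (n + 1) ^ 2 + α * β (n + 1) =
        ((n : ℂ) + 1) • (1 : Matrix (Fin N) (Fin N) ℂ) := by
  intro n hn
  induction n, hn using Nat.le_induction with
  | base =>
    rw [mul_sub] at h2
    rw [Nat.cast_one, add_smul, one_smul]
    nth_rewrite 1 [← h2]
    rw [← h3]
    norm_num
    abel
  | succ k hk ih =>
    have h := h1 (k + 1) (by lia)
    rw [mul_sub, Nat.add_sub_cancel] at h
    rw [Nat.cast_succ, add_smul, ← ih, one_smul, ← h]
    abel
end

section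
/- Let α ∈ ℂ^{N×N} and let (β_n)_{n≥0} in ℂ^{N×N} satisfy β_0 = 0, each β_n invertible for n ≥ 1, and β_{n+1} = n β_n^{−1} − β_{n−1} − β_n − α for all n ≥ 1. Suppose that for some m ≥ 1 there is an invertible M ∈ ℂ^{N×N} such that M^{−1} β_{m+1} M, M^{−1} β_m M and M^{−1} α M are all lower triangular. Then M^{−1} β_n M is lower triangular for every n ≥ 0. -/
open Matrix

/-- A matrix is lower triangular if all entries strictly above the diagonal vanish. -/
def LowerTriangular {N : ℕ} (T : Matrix (Fin N) (Fin N) ℂ) : Prop :=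
  ∀ i j : Fin N, i < j → T i j = 0

theorem lowerTriangular_iff_blockTriangular {N : ℕ} {T : Matrix (Fin N) (Fin N) ℂ} :
    LowerTriangular T ↔ T.BlockTriangular OrderDual.toDual :=
  Iff.rfl

namespace LowerTriangular

variable {N : ℕ} {S T : Matrix (Fin N) (Fin N) ℂ}

theorem sub (hS : LowerTriangular S) (hT : LowerTriangular T) : LowerTriangular (S - T) :=
  fun i j hij => by simp [hS i j hij, hT i j hij]

theorem smul (c : ℂ) (hT : LowerTriangular T) : LowerTriangular (c • T) :=
  fun i j hij => by simp [hT i j hij]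

theorem inv (hT : LowerTriangular T) (hu : IsUnit T) : LowerTriangular T⁻¹ := by
  have := hu.invertible
  rw [lowerTriangular_iff_blockTriangular] at hT ⊢
  exact blockTriangular_inv_of_blockTriangular hT

/-- If a conjugate of an invertible matrix is lower triangular, so is that of its inverse. -/
theorem conj_inv {M : Matrix (Fin N) (Fin N) ℂ} (hM : IsUnit M) (hu : IsUnit T)
    (hT : LowerTriangular (M⁻¹ * T * M)) : LowerTriangular (M⁻¹ * T⁻¹ * M) := by
  have hMi : IsUnit M⁻¹ := (isUnit_nonsing_inv_iff).2 hM
  have h := hT.inv ((hMi.mul hu).mul hM)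
  rwa [Matrix.mul_inv_rev, Matrix.mul_inv_rev,
    nonsing_inv_nonsing_inv _ ((isUnit_iff_isUnit_det M).1 hM),
    ← mul_assoc] at h

end LowerTriangular

/-- Let `(β_n)_{n≥0}` satisfy `β_0 = 0`, each `β_n` invertible for `n ≥ 1`,
and `β_{n+1} = n β_n⁻¹ − β_{n−1} − β_n − α` for all `n ≥ 1`. If for some `m ≥ 1` there is an
invertible `M` such that `M⁻¹ β_{m+1} M`, `M⁻¹ β_m M` and `M⁻¹ α M` are lower triangular,
then `M⁻¹ β_n M` is lower triangular for every `n ≥ 0`. -/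
theorem backward_triangularization
    {N : ℕ} (hN : 1 ≤ N) (α : Matrix (Fin N) (Fin N) ℂ)
    (β : ℕ → Matrix (Fin N) (Fin N) ℂ)
    (hβ0 : β 0 = 0)
    (hβinv : ∀ n : ℕ, 1 ≤ n → IsUnit (β n))
    (hrec : ∀ n : ℕ, 1 ≤ n →
      β (n + 1) = (n : ℂ) • (β n)⁻¹ - β (n - 1) - β n - α)
    (m : ℕ) (hm : 1 ≤ m)
    (M : Matrix (Fin N) (Fin N) ℂ) (hM : IsUnit M)
    (h1 : LowerTriangular (M⁻¹ * β (m + 1) * M))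
    (h2 : LowerTriangular (M⁻¹ * β m * M))
    (hγ : LowerTriangular (M⁻¹ * α * M)) :
    ∀ n : ℕ, LowerTriangular (M⁻¹ * β n * M) := by
  have h_inv (n : ℕ) (h : LowerTriangular (M⁻¹ * β (n + 1) * M)) :
      LowerTriangular (((n + 1 : ℕ) : ℂ) • (M⁻¹ * (β (n + 1))⁻¹ * M)) :=
    (h.conj_inv hM (hβinv _ n.succ_pos)).smul _
  have h_rec (n : ℕ) : M⁻¹ * β (n + 2) * M =
      ((n + 1 : ℕ) : ℂ) • (M⁻¹ * (β (n + 1))⁻¹ * M) - M⁻¹ * β n * M -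
        M⁻¹ * β (n + 1) * M - M⁻¹ * α * M := by
    rw [hrec (n + 1) n.succ_pos, Nat.add_sub_cancel]
    simp only [mul_sub, sub_mul, mul_smul_comm, smul_mul_assoc]
  have h_zero : LowerTriangular (M⁻¹ * β 0 * M) ∧ LowerTriangular (M⁻¹ * β 1 * M) := by
    clear hm
    induction m with
    | zero => exact ⟨h2, h1⟩
    | succ k ih =>
      refine ih h2 ?_
      have h_back : M⁻¹ * β k * M =
          ((k + 1 : ℕ) : ℂ) • (M⁻¹ * (β (k + 1))⁻¹ * M) - M⁻¹ * β (k + 2) * M -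
            M⁻¹ * β (k + 1) * M - M⁻¹ * α * M := by
        rw [h_rec k]
        abel
      rw [h_back]
      exact (((h_inv k h2).sub h1).sub h2).sub hγ
  have h_pair (n : ℕ) :
      LowerTriangular (M⁻¹ * β n * M) ∧ LowerTriangular (M⁻¹ * β (n + 1) * M) := by
    induction n with
    | zero => exact h_zero
    | succ k ih =>
      refine ⟨ih.2, ?_⟩
      rw [h_rec k]
      exact (((h_inv k ih.2).sub ih.1).sub ih.2).sub hγ
  exact fun n => (h_pair n).1
end

section
/- Let m ≥ 1 be an integer, α, a, b, c ∈ ℂ with b ≠ 0, and ε₀ > 0. Let d_{m−1}, d_m, d_{m+1}, d_{m+2}, d_{m+3}, d_{m+4} : (0, ε₀) → ℂ be functions such that d_m, d_{m+1}, d_{m+2}, d_{m+3} are nonvanishing and d_{n+1}(ε) = n / d_n(ε) − d_{n−1}(ε) − d_n(ε) − α for n = m, m+1, m+2, m+3 and all ε ∈ (0, ε₀). Assume d_{m−1}(ε) = a + O(ε) and d_m(ε) = b ε + c ε² + O(ε³) as ε → 0⁺. Then, as ε → 0⁺: d_{m+1}(ε) = (m/b) ε^{−1} − a − m c/b² − α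 + O(ε); d_{m+2}(ε) = −(m/b) ε^{−1} + a + m c/b² + O(ε); d_{m+3}(ε) = −(b(m+3)/m) ε + O(ε²); and d_{m+4}(ε) = (m a − 2α)/(m+3) + O(ε). In particular the singularity caused by d_m being of order ε is confined: d_{m+4} has a finite limit. -/
open Filter Asymptotics
open scoped Topology

/-- Inversion of a first-order expansion with nonzero constant term. -/
theorem isBigO_inv_sub_of_isBigO_sub {v : ℝ → ℂ} {p q : ℂ} (hp : p ≠ 0)
    (hv : (fun ε : ℝ => v ε - (p + q * (ε : ℂ))) =O[𝓝[>] (0 : ℝ)] fun ε : ℝ => ε ^ 2) :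
    (fun ε : ℝ => (v ε)⁻¹ - (p⁻¹ - q / p ^ 2 * (ε : ℂ))) =O[𝓝[>] (0 : ℝ)]
      fun ε : ℝ => ε ^ 2 := by
  have hε : Tendsto (fun ε : ℝ => (ε : ℂ)) (𝓝[>] (0 : ℝ)) (𝓝 0) := by
    have h : Tendsto (fun ε : ℝ => (ε : ℂ)) (𝓝 (0 : ℝ)) (𝓝 ((0 : ℝ) : ℂ)) :=
      Complex.continuous_ofReal.tendsto 0
    simpa using h.mono_left nhdsWithin_le_nhds
  have hsq : Tendsto (fun ε : ℝ => ε ^ 2) (𝓝[>] (0 : ℝ)) (𝓝 0) := by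
    have h : Tendsto (fun ε : ℝ => ε ^ 2) (𝓝 (0 : ℝ)) (𝓝 (0 ^ 2)) :=
      (continuous_pow 2).tendsto 0
    simpa using h.mono_left nhdsWithin_le_nhds
  have hvp : Tendsto v (𝓝[>] (0 : ℝ)) (𝓝 p) := by
    have h := (hv.trans_tendsto hsq).add ((hε.const_mul q).const_add p)
    simpa using h
  have hinv : (fun ε : ℝ => (v ε)⁻¹) =O[𝓝[>] (0 : ℝ)] fun _ : ℝ => (1 : ℝ) :=
    (hvp.inv₀ hp).isBigO_one ℝ
  have hw : (fun ε : ℝ => p⁻¹ - q / p ^ 2 * (ε : ℂ)) =O[𝓝[>] (0 : ℝ)]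
      fun _ : ℝ => (1 : ℝ) :=
    ((hε.const_mul (q / p ^ 2)).const_sub p⁻¹).isBigO_one ℝ
  have hquad : (fun ε : ℝ => q ^ 2 / p ^ 2 * (ε : ℂ) ^ 2) =O[𝓝[>] (0 : ℝ)]
      fun ε : ℝ => ε ^ 2 :=
    (isBigO_of_le _ fun ε => by simp).const_mul_left _
  have hmain := hinv.mul (hquad.sub ((hv.mul hw).congr_right fun ε => mul_one _))
  refine hmain.congr' ?_ (Eventually.of_forall fun ε => one_mul _)
  filter_upwards [hvp.eventually_ne hp] with ε hne
  field_simp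
  ring

/-- Inversion of a second-order expansion at a simple zero. -/
theorem isBigO_inv_sub_of_simple_zero {u : ℝ → ℂ} {p q : ℂ} (hp : p ≠ 0)
    (hu : (fun ε : ℝ => u ε - (p * (ε : ℂ) + q * (ε : ℂ) ^ 2)) =O[𝓝[>] (0 : ℝ)]
      fun ε : ℝ => ε ^ 3) :
    (fun ε : ℝ => (u ε)⁻¹ - (p⁻¹ * (ε : ℂ)⁻¹ - q / p ^ 2)) =O[𝓝[>] (0 : ℝ)]
      fun ε : ℝ => ε := by
  have hε : (fun ε : ℝ => (ε : ℂ)⁻¹) =O[𝓝[>] (0 : ℝ)] fun ε : ℝ => ε⁻¹ :=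
    isBigO_of_le _ fun ε => by simp
  have hscaled : (fun ε : ℝ => (ε : ℂ)⁻¹ * u ε - (p + q * (ε : ℂ))) =O[𝓝[>] (0 : ℝ)]
      fun ε : ℝ => ε ^ 2 := by
    refine (hε.mul hu).congr' ?_ ?_ <;> filter_upwards [self_mem_nhdsWithin] with ε hpos
    · have h : (ε : ℂ) ≠ 0 := Complex.ofReal_ne_zero.2 (ne_of_gt hpos)
      field_simp
    · have h : ε ≠ 0 := ne_of_gt hpos
      field_simp
  refine (hε.mul (isBigO_inv_sub_of_isBigO_sub hp hscaled)).congr' ?_ ?_ <;>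
    filter_upwards [self_mem_nhdsWithin] with ε hpos
  · have h : (ε : ℂ) ≠ 0 := Complex.ofReal_ne_zero.2 (ne_of_gt hpos)
    rw [mul_inv, inv_inv, mul_sub, mul_sub, inv_mul_cancel_left₀ h]
    field_simp
  · have h : ε ≠ 0 := ne_of_gt hpos
    field_simp

/-- Inversion of an expansion at a simple pole. -/
theorem isBigO_inv_sub_of_simple_pole {u : ℝ → ℂ} {p q : ℂ} (hp : p ≠ 0)
    (hu : (fun ε : ℝ => u ε - (p * (ε : ℂ)⁻¹ + q)) =O[𝓝[>] (0 : ℝ)] fun ε : ℝ => ε) :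
    (fun ε : ℝ => (u ε)⁻¹ - (p⁻¹ * (ε : ℂ) - q / p ^ 2 * (ε : ℂ) ^ 2)) =O[𝓝[>] (0 : ℝ)]
      fun ε : ℝ => ε ^ 3 := by
  have hε : (fun ε : ℝ => (ε : ℂ)) =O[𝓝[>] (0 : ℝ)] fun ε : ℝ => ε :=
    isBigO_of_le _ fun ε => by simp
  have hscaled : (fun ε : ℝ => (ε : ℂ) * u ε - (p + q * (ε : ℂ))) =O[𝓝[>] (0 : ℝ)]
      fun ε : ℝ => ε ^ 2 := by
    refine (hε.mul hu).congr' ?_ (Eventually.of_forall fun ε => (sq ε).symm)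
    filter_upwards [self_mem_nhdsWithin] with ε hpos
    have h : (ε : ℂ) ≠ 0 := Complex.ofReal_ne_zero.2 (ne_of_gt hpos)
    field_simp
  refine (hε.mul (isBigO_inv_sub_of_isBigO_sub hp hscaled)).congr' ?_
    (Eventually.of_forall fun ε => (pow_succ' ε 2).symm)
  filter_upwards [self_mem_nhdsWithin] with ε hpos
  have h : (ε : ℂ) ≠ 0 := Complex.ofReal_ne_zero.2 (ne_of_gt hpos)
  rw [mul_inv, mul_sub, mul_inv_cancel_left₀ h]
  ring

/-- Scalar singularity confinement for the discrete Painlevé I recursion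
`d_{n+1} = n/d_n − d_{n−1} − d_n − α`: if `d_{m−1}(ε) = a + O(ε)` and
`d_m(ε) = b ε + c ε² + O(ε³)` with `b ≠ 0` as `ε → 0⁺`, then
`d_{m+1}(ε) = (m/b) ε⁻¹ − a − mc/b² − α + O(ε)`,
`d_{m+2}(ε) = −(m/b) ε⁻¹ + a + mc/b² + O(ε)`,
`d_{m+3}(ε) = −(b(m+3)/m) ε + O(ε²)`, and
`d_{m+4}(ε) = (ma − 2α)/(m+3) + O(ε)`; in particular `d_{m+4}` has a finite limit. -/
theorem scalar_singularity_confinement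
    (m : ℕ) (hm : 1 ≤ m) (α a b c : ℂ) (hb : b ≠ 0) (ε₀ : ℝ) (hε₀ : 0 < ε₀)
    (d : ℕ → ℝ → ℂ)
    (hne : ∀ n : ℕ, m ≤ n → n ≤ m + 3 → ∀ ε ∈ Set.Ioo (0 : ℝ) ε₀, d n ε ≠ 0)
    (hrec : ∀ n : ℕ, m ≤ n → n ≤ m + 3 → ∀ ε ∈ Set.Ioo (0 : ℝ) ε₀,
      d (n + 1) ε = (n : ℂ) / d n ε - d (n - 1) ε - d n ε - α)
    (hdm1 : (fun ε : ℝ => d (m - 1) ε - a) =O[𝓝[>] (0 : ℝ)] fun ε : ℝ => ε)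
    (hdm : (fun ε : ℝ => d m ε - (b * (ε : ℂ) + c * (ε : ℂ) ^ 2))
      =O[𝓝[>] (0 : ℝ)] fun ε : ℝ => ε ^ 3) :
    ((fun ε : ℝ => d (m + 1) ε -
        (((m : ℂ) / b) * ((ε : ℂ))⁻¹ - a - (m : ℂ) * c / b ^ 2 - α))
        =O[𝓝[>] (0 : ℝ)] fun ε : ℝ => ε) ∧
    ((fun ε : ℝ => d (m + 2) ε -
        (-(((m : ℂ) / b)) * ((ε : ℂ))⁻¹ + a + (m : ℂ) * c / b ^ 2))
        =O[𝓝[>] (0 : ℝ)] fun ε : ℝ => ε) ∧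
    ((fun ε : ℝ => d (m + 3) ε - (-(b * ((m : ℂ) + 3) / (m : ℂ))) * (ε : ℂ))
        =O[𝓝[>] (0 : ℝ)] fun ε : ℝ => ε ^ 2) ∧
    ((fun ε : ℝ => d (m + 4) ε - ((m : ℂ) * a - 2 * α) / ((m : ℂ) + 3))
        =O[𝓝[>] (0 : ℝ)] fun ε : ℝ => ε) ∧
    Tendsto (d (m + 4)) (𝓝[>] (0 : ℝ))
      (𝓝 (((m : ℂ) * a - 2 * α) / ((m : ℂ) + 3))) := by
  have hm0 : (m : ℂ) ≠ 0 := Nat.cast_ne_zero.2 (by omega)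
  have hm3 : (m : ℂ) + 3 ≠ 0 := by exact_mod_cast (by omega : m + 3 ≠ 0)
  have hp : (m : ℂ) / b ≠ 0 := div_ne_zero hm0 hb
  have hIoo : Set.Ioo (0 : ℝ) ε₀ ∈ 𝓝[>] (0 : ℝ) := Ioo_mem_nhdsGT hε₀
  have hone : (fun ε : ℝ => (ε : ℂ)) =O[𝓝[>] (0 : ℝ)] fun ε : ℝ => ε :=
    isBigO_of_le _ fun ε => by simp
  have htwo : (fun ε : ℝ => (ε : ℂ) ^ 2) =O[𝓝[>] (0 : ℝ)] fun ε : ℝ => ε ^ 2 :=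
    isBigO_of_le _ fun ε => by simp
  have h21 : (fun ε : ℝ => ε ^ 2) =O[𝓝[>] (0 : ℝ)] fun ε : ℝ => ε :=
    (isLittleO_pow_id one_lt_two).isBigO.mono nhdsWithin_le_nhds
  have h31 : (fun ε : ℝ => ε ^ 3) =O[𝓝[>] (0 : ℝ)] fun ε : ℝ => ε :=
    (isLittleO_pow_id (by norm_num)).isBigO.mono nhdsWithin_le_nhds
  have h32 : (fun ε : ℝ => ε ^ 3) =O[𝓝[>] (0 : ℝ)] fun ε : ℝ => ε ^ 2 :=
    (isLittleO_pow_pow (by norm_num)).isBigO.mono nhdsWithin_le_nhds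
  have hd0 : d m =O[𝓝[>] (0 : ℝ)] fun ε : ℝ => ε :=
    ((hdm.trans h31).add ((hone.const_mul_left b).add
      ((htwo.trans h21).const_mul_left c))).congr_left fun ε => by ring
  have hd1 : (fun ε : ℝ => d (m + 1) ε -
      (((m : ℂ) / b) * ((ε : ℂ))⁻¹ - a - (m : ℂ) * c / b ^ 2 - α))
      =O[𝓝[>] (0 : ℝ)] fun ε : ℝ => ε := by
    refine ((((isBigO_inv_sub_of_simple_zero hb hdm).const_mul_left (m : ℂ)).sub
      hdm1).sub hd0).congr' ?_ EventuallyEq.rfl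
    filter_upwards [hIoo] with ε hε
    rw [hrec m le_rfl (by omega) ε hε]
    ring
  have hi1 := isBigO_inv_sub_of_simple_pole (q := -a - (m : ℂ) * c / b ^ 2 - α) hp
    (hd1.congr_left fun ε => by ring)
  have hj1 : (fun ε : ℝ => (d (m + 1) ε)⁻¹) =O[𝓝[>] (0 : ℝ)] fun ε : ℝ => ε :=
    ((hi1.trans h31).add ((hone.const_mul_left ((m : ℂ) / b)⁻¹).sub
      ((htwo.trans h21).const_mul_left ((-a - (m : ℂ) * c / b ^ 2 - α) /
        ((m : ℂ) / b) ^ 2)))).congr_left fun ε => by ring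
  have hd2 : (fun ε : ℝ => d (m + 2) ε -
      (-(((m : ℂ) / b)) * ((ε : ℂ))⁻¹ + a + (m : ℂ) * c / b ^ 2))
      =O[𝓝[>] (0 : ℝ)] fun ε : ℝ => ε := by
    refine (((hj1.const_mul_left ((m : ℂ) + 1)).sub hd0).sub hd1).congr' ?_ EventuallyEq.rfl
    filter_upwards [hIoo] with ε hε
    rw [hrec (m + 1) (by omega) (by omega) ε hε, Nat.add_sub_cancel]
    push_cast
    ring
  have hi2 := isBigO_inv_sub_of_simple_pole (q := a + (m : ℂ) * c / b ^ 2) (neg_ne_zero.2 hp)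
    (hd2.congr_left fun ε => by ring)
  have hd3 : (fun ε : ℝ => d (m + 3) ε - (-(b * ((m : ℂ) + 3) / (m : ℂ)) * (ε : ℂ) +
      (c - b ^ 2 / (m : ℂ) ^ 2 * ((2 * (m : ℂ) + 3) * (a + (m : ℂ) * c / b ^ 2) +
        ((m : ℂ) + 1) * α)) * (ε : ℂ) ^ 2)) =O[𝓝[>] (0 : ℝ)] fun ε : ℝ => ε ^ 3 := by
    refine (((hi2.const_mul_left ((m : ℂ) + 2)).sub
      (hi1.const_mul_left ((m : ℂ) + 1))).add hdm).congr' ?_ EventuallyEq.rfl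
    filter_upwards [hIoo] with ε hε
    have h2 : d (m + 2) ε = _ := hrec (m + 1) (by omega) (by omega) ε hε
    rw [hrec (m + 2) (by omega) (by omega) ε hε, show m + 2 - 1 = m + 1 by omega,
      div_eq_mul_inv _ (d (m + 2) ε)]
    generalize (d (m + 2) ε)⁻¹ = x
    rw [h2, Nat.add_sub_cancel, div_eq_mul_inv _ (d (m + 1) ε)]
    generalize (d (m + 1) ε)⁻¹ = y
    push_cast
    field_simp
    ring
  have he : -(b * ((m : ℂ) + 3) / (m : ℂ)) ≠ 0 :=
    neg_ne_zero.2 (div_ne_zero (mul_ne_zero hb hm3) hm0)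
  have hd3' : (fun ε : ℝ => d (m + 3) ε - (-(b * ((m : ℂ) + 3) / (m : ℂ))) * (ε : ℂ))
      =O[𝓝[>] (0 : ℝ)] fun ε : ℝ => ε ^ 2 :=
    ((hd3.trans h32).add (htwo.const_mul_left _)).congr_left fun ε => by
      rw [← sub_sub, sub_add_cancel]
  have hd3'' : d (m + 3) =O[𝓝[>] (0 : ℝ)] fun ε : ℝ => ε :=
    ((hd3'.trans h21).add (hone.const_mul_left _)).congr_left fun ε => sub_add_cancel _ _
  have hd4 : (fun ε : ℝ => d (m + 4) ε - ((m : ℂ) * a - 2 * α) / ((m : ℂ) + 3))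
      =O[𝓝[>] (0 : ℝ)] fun ε : ℝ => ε := by
    refine ((((isBigO_inv_sub_of_simple_zero he hd3).const_mul_left ((m : ℂ) + 3)).sub
      hd2).sub hd3'').congr' ?_ EventuallyEq.rfl
    filter_upwards [hIoo] with ε hε
    have hε0 : (ε : ℂ) ≠ 0 := Complex.ofReal_ne_zero.2 hε.1.ne'
    rw [hrec (m + 3) (by omega) (by omega) ε hε, show m + 3 - 1 = m + 2 by omega]
    push_cast
    rw [div_eq_mul_inv _ (d (m + 3) ε)]
    generalize (d (m + 3) ε)⁻¹ = x
    field_simp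
    ring
  refine ⟨hd1, hd2, hd3', hd4, ?_⟩
  have hid : Tendsto (fun ε : ℝ => ε) (𝓝[>] (0 : ℝ)) (𝓝 0) := nhdsWithin_le_nhds
  exact tendsto_sub_nhds_zero_iff.1 (hd4.trans_tendsto hid)
end
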